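/- Let A be an algebra, S and T tolerances on A, and δ, δ' congruences on A. If T ∩ δ = T ∩ δ', then C(S,T;δ) holds if and only if C(S,T;δ') holds. -/

import Mathlib

open FirstOrder.Language FirstOrder.Language.Structure

universe u v w

/-- A binary relation on `A` is compatible with all (interpreted) operations of the
`L`-structure `A`. -/
def Compatible (L : FirstOrder.Language.{u, v}) (A : Type w) [L.Structure A]
    (T : A → A → Prop) : Prop :=
  ∀ (n : ℕ) (f : L.Functions n) (a b : Fin n → A),
    (∀ i, T (a i) (b i)) → T (funMap f a) (funMap f b)

/-- A tolerance on `A`: a reflexive, symmetric, compatible binary relation. -/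
def IsTolerance (L : FirstOrder.Language.{u, v}) (A : Type w) [L.Structure A]
    (T : A → A → Prop) : Prop :=
  Reflexive T ∧ Symmetric T ∧ Compatible L A T

/-- A congruence on `A`: a transitive tolerance. -/
def IsCongruence (L : FirstOrder.Language.{u, v}) (A : Type w) [L.Structure A]
    (T : A → A → Prop) : Prop :=
  IsTolerance L A T ∧ Transitive T

/-- The centralizer condition `C(S, T; δ)`: for every term `t(x, y₁, …, yₙ)`
(variable `0` playing the role of `x`), every `(a, b) ∈ S` and all pairs
`(uᵢ, vᵢ) ∈ T`, if `(t(a, ū), t(a, v̄)) ∈ δ` then `(t(b, ū), t(b, v̄)) ∈ δ`. -/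
def Centralizes (L : FirstOrder.Language.{u, v}) (A : Type w) [L.Structure A]
    (S T δ : A → A → Prop) : Prop :=
  ∀ (n : ℕ) (t : L.Term (Fin (n + 1))) (a b : A), S a b →
    ∀ u v : Fin n → A, (∀ i, T (u i) (v i)) →
      (δ (t.realize (Fin.cons a u)) (t.realize (Fin.cons a v)) →
        δ (t.realize (Fin.cons b u)) (t.realize (Fin.cons b v)))

theorem Compatible.realize {L : FirstOrder.Language.{u, v}} {A : Type w} [L.Structure A]
    {T : A → A → Prop} (hT : Compatible L A T) {α : Type*} (t : L.Term α) {x y : α → A}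
    (hxy : ∀ i, T (x i) (y i)) : T (t.realize x) (t.realize y) := by
  induction t with
  | var i => exact hxy i
  | func f ts ih => exact hT _ f _ _ ih

theorem IsTolerance.realize_cons {L : FirstOrder.Language.{u, v}} {A : Type w} [L.Structure A]
    {T : A → A → Prop} (hT : IsTolerance L A T) {n : ℕ} (t : L.Term (Fin (n + 1))) (a : A)
    {x y : Fin n → A} (hxy : ∀ i, T (x i) (y i)) :
    T (t.realize (Fin.cons a x)) (t.realize (Fin.cons a y)) :=
  hT.2.2.realize t (Fin.cases (hT.1 a) hxy)

theorem Centralizes.of_inter_iff {L : FirstOrder.Language.{u, v}} {A : Type w} [L.Structure A]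
    {S T δ δ' : A → A → Prop} (hT : IsTolerance L A T)
    (h : ∀ a b, T a b → (δ a b ↔ δ' a b)) (hC : Centralizes L A S T δ) :
    Centralizes L A S T δ' := fun n t a b hab x y hxy hδ' =>
  (h _ _ (hT.realize_cons t b hxy)).1
    (hC n t a b hab x y hxy ((h _ _ (hT.realize_cons t a hxy)).2 hδ'))

/-- Theorem 2.19 (4): if `T ∩ δ = T ∩ δ'`, then `C(S, T; δ)` holds iff
`C(S, T; δ')` holds. -/
theorem centralizes_iff_of_inter_eq {L : FirstOrder.Language.{u, v}}
    {A : Type w} [L.Structure A] (S T δ δ' : A → A → Prop)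
    (hS : IsTolerance L A S) (hT : IsTolerance L A T)
    (hδ : IsCongruence L A δ) (hδ' : IsCongruence L A δ')
    (h : (fun a b => T a b ∧ δ a b) = (fun a b => T a b ∧ δ' a b)) :
    Centralizes L A S T δ ↔ Centralizes L A S T δ' := by
  have key : ∀ a b, T a b → (δ a b ↔ δ' a b) := fun a b hab =>
    and_congr_right_iff.1 (iff_of_eq (congrFun₂ h a b)) hab
  exact ⟨.of_inter_iff hT key, .of_inter_iff hT fun a b hab => (key a b hab).symm⟩
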